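/- Let n, m ≥ 2 with m and n both even. In the group S_{n×m} of E-preserving permutations of Fin n × Fin m, with products written left-to-right (αβ means 'first α, then β'), the following identities hold: π = (ξ1^{m-1} ξ2^2)^{(m-2)(n-1)^2} (ξ1 ξ2^2)^{(m-1)(n^2-n-1)} (ξ1 ξ2)^m; ρ = ((ξ1^{m-1} ξ2^2)^{(m-2)(n-1)^2} (ξ1 ξ2^2)^{(m-1)(n^2-n-1)})^{n-1}; π̄ = ξ2^{2n-1} ((ξ1^{m-1} ξ2^2)^{(m-2)(n-1)^2} (ξ1 ξ2^2)^{(m-1)(n^2-n-1)})^{n-1}; ρ̄ = ξ2^{2n-1} ((ξ1^{m-1} ξ2^2)^{(m-2)(n-1)^2} (ξ1 ξ2^2)^{(m-1)(n^2-n-1)})^{n} (ξ1 ξ2)^m ξ2^{2n-1} ξ1 ξ2. -/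

import Mathlib

/-- The permutation `s̄` of `Fin m` (0-indexed): the cycle `(2 3 ⋯ m)` if both `m`
and `n` are even, and the cycle `(1 2 ⋯ m)` otherwise. -/
def sbar (n m : ℕ) (hm : 2 ≤ m) : Equiv.Perm (Fin m) :=
  if Even m ∧ Even n then
    (finRotate m).trans (Equiv.swap (⟨0, by omega⟩ : Fin m) ⟨1, by omega⟩)
  else finRotate m

/-- The permutation `ξ1` of `Fin n × Fin m` (all 0-indexed): it sends
`(i,1) ↦ ((0 1)i, s̄ 1)` and `(i,j) ↦ (i, s̄ j)` for `j ≠ 1`. -/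
def xi1 (n m : ℕ) (hn : 2 ≤ n) (hm : 2 ≤ m) : Equiv.Perm (Fin n × Fin m) :=
  (Equiv.prodComm (Fin n) (Fin m)).trans
    ((Equiv.prodShear (sbar n m hm)
        (fun j => if j = (⟨1, by omega⟩ : Fin m) then
            Equiv.swap (⟨0, by omega⟩ : Fin n) ⟨1, by omega⟩
          else Equiv.refl (Fin n))).trans
      (Equiv.prodComm (Fin m) (Fin n)))

/-- The permutation `ξ2` of `Fin n × Fin m` (all 0-indexed): it sends
`(i,0) ↦ ((0 1 ⋯ n-1)i, 1)`, `(i,1) ↦ (i,0)`, and fixes `(i,j)` for `j ≥ 2`. -/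
def xi2 (n m : ℕ) (hn : 2 ≤ n) (hm : 2 ≤ m) : Equiv.Perm (Fin n × Fin m) :=
  (Equiv.prodComm (Fin n) (Fin m)).trans
    ((Equiv.prodShear (Equiv.swap (⟨0, by omega⟩ : Fin m) ⟨1, by omega⟩)
        (fun j => if j = (⟨0, by omega⟩ : Fin m) then finRotate n else Equiv.refl (Fin n))).trans
      (Equiv.prodComm (Fin m) (Fin n)))
/-- `π`: the permutation of `Fin n × Fin m` swapping `(0,0)` and `(1,0)` (0-indexed). -/
def piP (n m : ℕ) (hn : 2 ≤ n) (hm : 2 ≤ m) : Equiv.Perm (Fin n × Fin m) :=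
  Equiv.swap ((⟨0, by omega⟩ : Fin n), (⟨0, by omega⟩ : Fin m))
    ((⟨1, by omega⟩ : Fin n), (⟨0, by omega⟩ : Fin m))

/-- `ρ`: the permutation sending `(i,0) ↦ ((0 1 ⋯ n-1)i, 0)` and fixing all `(i,j)`, `j ≠ 0`. -/
def rhoP (n m : ℕ) (hn : 2 ≤ n) (hm : 2 ≤ m) : Equiv.Perm (Fin n × Fin m) :=
  (Equiv.prodComm (Fin n) (Fin m)).trans
    ((Equiv.prodShear (Equiv.refl (Fin m))
        (fun j => if j = (⟨0, by omega⟩ : Fin m) then finRotate n else Equiv.refl (Fin n))).trans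
      (Equiv.prodComm (Fin m) (Fin n)))

/-- `π̄`: the permutation swapping `(i,0) ↔ (i,1)` for every `i` and fixing all other points. -/
def pibarP (n m : ℕ) (hn : 2 ≤ n) (hm : 2 ≤ m) : Equiv.Perm (Fin n × Fin m) :=
  Equiv.prodCongr (Equiv.refl (Fin n)) (Equiv.swap (⟨0, by omega⟩ : Fin m) ⟨1, by omega⟩)

/-- `ρ̄`: the permutation sending `(i,j) ↦ (i, (0 1 ⋯ m-1)j)`. -/
def rhobarP (n m : ℕ) : Equiv.Perm (Fin n × Fin m) :=
  Equiv.prodCongr (Equiv.refl (Fin n)) (finRotate m)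

/-- The permutation of `α × β` acting on the fibre over `j` by `f j`. -/
def fiberwise {α β : Type*} : (β → Equiv.Perm α) →* Equiv.Perm (α × β) where
  toFun f :=
    { toFun := fun p => (f p.2 p.1, p.2)
      invFun := fun p => ((f p.2)⁻¹ p.1, p.2)
      left_inv := fun p => by simp
      right_inv := fun p => by simp }
  map_one' := by ext p <;> simp
  map_mul' f g := by ext p <;> simp

theorem fiberwise_apply {α β : Type*} (f : β → Equiv.Perm α) (i : α) (j : β) :
    fiberwise f (i, j) = (f j i, j) := rfl

/-- If `x` carries the fibres over `y 0, …, y N = y 0` cyclically to each other, with accumulated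
action `a k` after `k` steps, then `x ^ N` acts on each of them by a conjugate of `a N`. -/
theorem pow_apply_of_cyclic_fibers {α β : Type*} (x : Equiv.Perm (α × β)) (N : ℕ) (y : ℕ → β)
    (a : ℕ → Equiv.Perm α) (ha : a 0 = 1) (hy : y N = y 0)
    (h : ∀ k < N, ∀ i, x (a k i, y k) = (a (k + 1) i, y (k + 1))) (k : ℕ) (hk : k ≤ N) (i : α) :
    (x ^ N) (i, y k) = ((a k * a N * (a k)⁻¹) i, y k) := by
  have key : ∀ l ≤ N, ∀ i, (x ^ l) (i, y 0) = (a l i, y l) := by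
    intro l
    induction l with
    | zero => simp [ha]
    | succ l ih =>
      intro hl i
      rw [pow_succ', Equiv.Perm.mul_apply, ih (by omega), h l (by omega)]
  have hi : (i, y k) = (x ^ k) ((a k)⁻¹ i, y 0) := by simp [key k hk]
  rw [hi, ← Equiv.Perm.mul_apply, (Commute.pow_pow_self x N k).eq, Equiv.Perm.mul_apply,
    key N le_rfl, hy, key k hk]
  simp

theorem finRotate_pow_self (n : ℕ) : finRotate n ^ n = 1 := by
  rcases n with _ | n
  · rfl
  have key : ∀ (k : ℕ) (i : Fin (n + 1)), (finRotate (n + 1) ^ k) i = i + Fin.ofNat (n + 1) k := by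
    intro k
    induction k with
    | zero => simp
    | succ k ih =>
      intro i
      rw [pow_succ', Equiv.Perm.mul_apply, ih, finRotate_apply]
      simp [Fin.ext_iff, Fin.val_add, add_assoc]
  ext i
  rw [key]
  simp

theorem swap_mul_finRotate_pow (n : ℕ) (hn : 2 ≤ n) :
    (Equiv.swap (⟨0, by omega⟩ : Fin n) ⟨1, by omega⟩ * finRotate n) ^ (n - 1) = 1 := by
  obtain ⟨n, rfl⟩ := Nat.exists_eq_add_of_le' hn
  change (Equiv.swap (0 : Fin (n + 2)) 1 * finRotate (n + 2)) ^ (n + 1) = 1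
  set E := Equiv.swap (0 : Fin (n + 2)) 1 * finRotate (n + 2) with hE
  have h0 : E 0 = 0 := by simp [hE]
  have hs : ∀ i : Fin (n + 1), E i.succ = (finRotate (n + 1) i).succ := by
    intro i
    rw [hE, finRotate_succ_eq_decomposeFin]
    simp [Equiv.Perm.decomposeFin_symm_apply_succ]
  have h0' : ∀ k : ℕ, (E ^ k) 0 = 0 := fun k => by
    induction k with
    | zero => rfl
    | succ k ih => rw [pow_succ', Equiv.Perm.mul_apply, ih, h0]
  have hs' : ∀ (k : ℕ) (i : Fin (n + 1)),
      (E ^ k) i.succ = ((finRotate (n + 1) ^ k) i).succ := fun k i => by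
    induction k with
    | zero => rfl
    | succ k ih => rw [pow_succ', Equiv.Perm.mul_apply, ih, hs, pow_succ', Equiv.Perm.mul_apply]
  refine Equiv.ext fun i => ?_
  refine Fin.cases (h0' _) (fun i => ?_) i
  rw [hs', finRotate_pow_self]
  rfl

theorem finRotate_mul_swap_pow (n : ℕ) (hn : 2 ≤ n) :
    (finRotate n * Equiv.swap (⟨0, by omega⟩ : Fin n) ⟨1, by omega⟩) ^ (n - 1) = 1 := by
  have h := swap_mul_finRotate_pow n hn
  rwa [← conj_eq_one_iff (a := Equiv.swap (⟨0, by omega⟩ : Fin n) ⟨1, by omega⟩), ← conj_pow,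
    ← mul_assoc, mul_inv_cancel_right]

theorem swap_zero_one_val (m : ℕ) (hm : 2 ≤ m) (j : Fin m) :
    (Equiv.swap (⟨0, by omega⟩ : Fin m) ⟨1, by omega⟩ j).val =
      if j.val = 0 then 1 else if j.val = 1 then 0 else j.val := by
  rw [Equiv.swap_apply_def]
  simp only [Fin.ext_iff]
  split_ifs <;> rfl

theorem finRotate_val (m : ℕ) (j : Fin m) :
    (finRotate m j).val = if j.val + 1 = m then 0 else j.val + 1 := by
  obtain _ | m := m
  · exact j.elim0
  rw [finRotate_apply, Fin.val_add_one]
  simp [Fin.ext_iff]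

theorem sbar_val (n m : ℕ) (hm : 2 ≤ m) (hme : Even m) (hne : Even n) (j : Fin m) :
    (sbar n m hm j).val =
      if j.val = 0 then 0 else if j.val + 1 = m then 1 else j.val + 1 := by
  rw [sbar, if_pos ⟨hme, hne⟩, Equiv.trans_apply, swap_zero_one_val m hm, finRotate_val]
  grind

/-- The transposition of the first two points of `Fin n`. -/
abbrev firstSwap (n : ℕ) (hn : 2 ≤ n) : Equiv.Perm (Fin n) :=
  Equiv.swap (⟨0, by omega⟩ : Fin n) ⟨1, by omega⟩

section Generators

variable (n m : ℕ) (hn : 2 ≤ n) (hm : 2 ≤ m)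

theorem xi1_apply (i : Fin n) (j : Fin m) :
    xi1 n m hn hm (i, j) =
      ((if j.val = 1 then firstSwap n hn else 1 : Equiv.Perm (Fin n)) i, sbar n m hm j) := by
  simp only [xi1, Fin.ext_iff]
  rfl

theorem xi2_apply (i : Fin n) (j : Fin m) :
    xi2 n m hn hm (i, j) =
      ((if j.val = 0 then finRotate n else 1 : Equiv.Perm (Fin n)) i, firstSwap m hm j) := by
  simp only [xi2, Fin.ext_iff]
  rfl

theorem piP_eq_fiberwise :
    piP n m hn hm = fiberwise fun j : Fin m => if j.val = 0 then firstSwap n hn else 1 := by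
  ext1 ⟨i, j⟩
  rw [fiberwise_apply, piP, Equiv.swap_apply_def]
  by_cases hj : j.val = 0
  · obtain ⟨j, hjm⟩ := j
    obtain rfl : j = 0 := hj
    simp only [Prod.mk.injEq, and_true, if_pos, firstSwap, Equiv.swap_apply_def]
    split_ifs <;> rfl
  · simp [hj, Fin.ext_iff]

theorem rhoP_eq_fiberwise :
    rhoP n m hn hm = fiberwise fun j : Fin m => if j.val = 0 then finRotate n else 1 := by
  ext1 ⟨i, j⟩
  simp only [rhoP, Fin.ext_iff]
  rfl

theorem xi2_sq :
    xi2 n m hn hm ^ 2 = fiberwise fun j : Fin m => if j.val < 2 then finRotate n else 1 := by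
  ext1 ⟨i, j⟩
  have hj := swap_zero_one_val m hm j
  simp only [fiberwise_apply, pow_two, Equiv.Perm.mul_apply, xi2_apply, Equiv.swap_apply_self, hj]
  grind [Equiv.Perm.one_apply]

theorem pow_apply_of_cyclic_nonzero_fibers (hme : Even m) (hne : Even n)
    (x : Equiv.Perm (Fin n × Fin m)) (t b : Equiv.Perm (Fin n))
    (hx : ∀ (i : Fin n) (j : Fin m), j.val ≠ 0 → x (i, j) =
      (((if j.val + 1 = m then b else 1) * (if j.val = 1 then t else 1) : Equiv.Perm (Fin n)) i,
        sbar n m hm j)) (i : Fin n) (j : Fin m) (hj : j.val ≠ 0) :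
    (x ^ (m - 1)) (i, j) = ((if j.val = 1 then b * t else t * b) i, j) := by
  have h := pow_apply_of_cyclic_fibers x (m - 1)
    (fun k => ⟨if k + 1 < m then k + 1 else 1, by split_ifs <;> omega⟩)
    (fun k => if k = 0 then 1 else if k = m - 1 then b * t else t) rfl
    (by rw [Fin.mk.injEq]; grind)
    (fun k hk i => by
      have hk' : k + 1 < m := by omega
      simp only [if_pos hk']
      rw [hx _ _ (by simp)]
      refine Prod.ext ?_ (Fin.ext ?_)
      · grind [Equiv.Perm.mul_apply, Equiv.Perm.one_apply]
      · rw [sbar_val n m hm hme hne]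
        grind) (j.val - 1) (by omega) i
  have hy : (⟨if j.val - 1 + 1 < m then j.val - 1 + 1 else 1, by split_ifs <;> omega⟩ : Fin m) = j :=
    Fin.ext (by grind)
  rw [hy] at h
  rw [h]
  congr 2
  have hm1 : m - 1 ≠ 0 := by omega
  have hj1 : j.val - 1 ≠ m - 1 := by omega
  by_cases h1 : j.val = 1
  · simp [h1, hm1]
  · have h2 : j.val - 1 ≠ 0 := by omega
    simp only [h1, h2, hm1, hj1, if_true, if_false]
    group

theorem xi1_pow (hme : Even m) (hne : Even n) :
    xi1 n m hn hm ^ (m - 1) =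
      fiberwise fun j : Fin m => if j.val = 0 then 1 else firstSwap n hn := by
  ext1 ⟨i, j⟩
  rw [fiberwise_apply]
  by_cases hj : j.val = 0
  · have h : Function.IsFixedPt (xi1 n m hn hm) (i, j) := by
      refine Prod.ext ?_ (Fin.ext ?_) <;> simp [xi1_apply, sbar_val n m hm hme hne, hj]
    rw [if_pos hj]
    exact h.perm_pow (m - 1)
  · rw [pow_apply_of_cyclic_nonzero_fibers n m hm hme hne _ (firstSwap n hn) 1
      (fun i j _ => by simp [xi1_apply]) i j hj]
    simp [hj]

theorem xi2_sq_mul_xi1_pow (hme : Even m) (hne : Even n) :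
    (xi2 n m hn hm ^ 2 * xi1 n m hn hm) ^ (m - 1) =
      fiberwise fun j : Fin m =>
        if j.val = 0 then finRotate n ^ (m - 1) else if j.val = 1 then finRotate n * firstSwap n hn
          else firstSwap n hn * finRotate n := by
  ext1 ⟨i, j⟩
  rw [fiberwise_apply]
  by_cases hj : j.val = 0
  · have h : ∀ i, (xi2 n m hn hm ^ 2 * xi1 n m hn hm) (i, j) = (finRotate n i, j) := by
      intro i
      rw [Equiv.Perm.mul_apply, xi1_apply, xi2_sq, fiberwise_apply]
      refine Prod.ext ?_ (Fin.ext ?_) <;> simp [sbar_val n m hm hme hne, hj]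
    rw [if_pos hj]
    generalize m - 1 = k
    induction k with
    | zero => rfl
    | succ k ih => rw [pow_succ', Equiv.Perm.mul_apply, ih, h, pow_succ', Equiv.Perm.mul_apply]
  · rw [pow_apply_of_cyclic_nonzero_fibers n m hm hme hne _ (firstSwap n hn) (finRotate n)
      (fun i j hj => by
        rw [Equiv.Perm.mul_apply, xi1_apply, xi2_sq, fiberwise_apply, sbar_val n m hm hme hne]
        grind [Equiv.Perm.mul_apply]) i j hj, if_neg hj]

theorem xi2_mul_xi1_pow (hme : Even m) (hne : Even n) :
    (xi2 n m hn hm * xi1 n m hn hm) ^ m =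
      fiberwise fun j : Fin m =>
        if j.val = 1 then finRotate n * firstSwap n hn else firstSwap n hn * finRotate n := by
  ext1 ⟨i, j⟩
  have h := pow_apply_of_cyclic_fibers (xi2 n m hn hm * xi1 n m hn hm) m
    (fun k => ⟨if k < m then k else 0, by split_ifs <;> omega⟩)
    (fun k => if k = 0 then 1 else if k = 1 then finRotate n else firstSwap n hn * finRotate n) rfl
    (by rw [Fin.mk.injEq]; grind)
    (fun k hk i => by
      simp only [if_pos hk]
      rw [Equiv.Perm.mul_apply, xi1_apply, xi2_apply]
      refine Prod.ext ?_ (Fin.ext ?_)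
      · rw [sbar_val n m hm hme hne]
        grind [Equiv.Perm.mul_apply, Equiv.Perm.one_apply]
      · rw [swap_zero_one_val m hm, sbar_val n m hm hme hne]
        grind) j.val j.isLt.le i
  simp only [if_pos j.isLt] at h
  rw [h, fiberwise_apply]
  congr 2
  have hm0 : m ≠ 0 := by omega
  have hm1 : m ≠ 1 := by omega
  simp only [hm0, hm1, if_false]
  split_ifs <;> first | omega | group

/-- The word occurring in all four identities, written as a fibrewise permutation. -/
theorem word_eq_fiberwise (hme : Even m) (hne : Even n) :
    (xi2 n m hn hm ^ 2 * xi1 n m hn hm) ^ ((m - 1) * (n ^ 2 - n - 1)) *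
        (xi2 n m hn hm ^ 2 * xi1 n m hn hm ^ (m - 1)) ^ ((m - 2) * (n - 1) ^ 2) =
      fiberwise fun j : Fin m =>
        if j.val = 0 then (finRotate n)⁻¹ else if j.val = 1 then (finRotate n * firstSwap n hn)⁻¹
          else (firstSwap n hn * finRotate n)⁻¹ := by
  rw [pow_mul, xi2_sq_mul_xi1_pow n m hn hm hme hne, xi1_pow n m hn hm hme hne, xi2_sq, ← map_mul,
    ← map_pow, ← map_pow, ← map_mul]
  congr 1
  funext j
  have hr := finRotate_pow_self n
  have htt : firstSwap n hn ^ 2 = 1 := by rw [pow_two, Equiv.swap_mul_self]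
  have htr := swap_mul_finRotate_pow n hn
  have hrt := finRotate_mul_swap_pow n hn
  have hexp : n ^ 2 - n - 1 + 1 = (n - 1) * n := by
    obtain ⟨n, rfl⟩ := Nat.exists_eq_add_of_le' hn
    have : (n + 2) ^ 2 = (n + 1) * (n + 2) + (n + 2) := by ring
    have h2 : 1 ≤ (n + 1) * (n + 2) := Nat.mul_pos (by omega) (by omega)
    rw [this, Nat.add_sub_cancel, Nat.sub_add_cancel h2]
    rfl
  simp only [Pi.mul_apply, Pi.pow_apply]
  by_cases h0 : j.val = 0
  · simp only [h0, if_true, Nat.ofNat_pos, mul_one]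
    rw [eq_inv_iff_mul_eq_one, ← pow_mul, ← pow_add, ← pow_succ]
    obtain ⟨c, hc⟩ : n ∣ (m - 1) * (n ^ 2 - n - 1) + (m - 2) * (n - 1) ^ 2 + 1 := by
      obtain ⟨p, rfl⟩ := Nat.exists_eq_add_of_le' hm
      obtain ⟨q, rfl⟩ := Nat.exists_eq_add_of_le' hn
      have hq : (q + 2) ^ 2 - (q + 2) - 1 = q ^ 2 + 3 * q + 1 := by
        have : (q + 2) ^ 2 = (q ^ 2 + 3 * q + 1) + 1 + (q + 2) := by ring
        omega
      refine ⟨(p + 1) * (q + 1) + p * q, ?_⟩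
      rw [hq, show p + 2 - 1 = p + 1 by omega, show p + 2 - 2 = p by omega,
        show q + 2 - 1 = q + 1 by omega]
      ring
    rw [hc, pow_mul, hr, one_pow]
  · by_cases h1 : j.val = 1
    · simp only [h1, if_true, if_false, one_ne_zero, Nat.one_lt_ofNat]
      rw [eq_inv_iff_mul_eq_one, show (m - 2) * (n - 1) ^ 2 = (n - 1) * ((m - 2) * (n - 1)) by ring,
        pow_mul _ (n - 1), hrt, one_pow, mul_one, ← pow_succ, hexp, pow_mul, hrt, one_pow]
    · have h2 : ¬ j.val < 2 := by omega
      obtain ⟨c, hc⟩ : 2 ∣ (m - 2) * (n - 1) ^ 2 :=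
        ((hme.tsub even_two).mul_right _).two_dvd
      simp only [h0, h1, h2, if_false, one_mul]
      rw [eq_inv_iff_mul_eq_one, hc, pow_mul _ 2, htt, one_pow, mul_one, ← pow_succ, hexp,
        pow_mul, htr, one_pow]

theorem xi2_eq : xi2 n m hn hm = pibarP n m hn hm * rhoP n m hn hm := by
  ext1 ⟨i, j⟩
  rw [Equiv.Perm.mul_apply, rhoP_eq_fiberwise, fiberwise_apply, xi2_apply]
  rfl

theorem xi2_mul_xi1_eq (hme : Even m) (hne : Even n) :
    xi2 n m hn hm * xi1 n m hn hm =
      rhobarP n m * (pibarP n m hn hm * piP n m hn hm * pibarP n m hn hm) * rhoP n m hn hm := by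
  ext1 ⟨i, j⟩
  have hpibar : ∀ i j, pibarP n m hn hm (i, j) = (i, firstSwap m hm j) := fun _ _ => rfl
  have hrhobar : ∀ i j, rhobarP n m (i, j) = (i, finRotate m j) := fun _ _ => rfl
  simp only [Equiv.Perm.mul_apply, rhoP_eq_fiberwise, piP_eq_fiberwise, fiberwise_apply, xi1_apply,
    xi2_apply, hpibar, hrhobar, Equiv.swap_apply_self]
  refine Prod.ext ?_ (Fin.ext ?_)
  · rw [sbar_val n m hm hme hne, swap_zero_one_val m hm]
    grind [Equiv.Perm.one_apply]
  · rw [swap_zero_one_val m hm, sbar_val n m hm hme hne, finRotate_val]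
    grind

end Generators

/-- The identities expressing `π, ρ, π̄, ρ̄` as words in `ξ1, ξ2` when `m` and `n` are
both even. Products in the paper are left-to-right; here `*` is right-to-left
composition of permutations, so each word is reversed. -/
theorem stmt16 (n m : ℕ) (hn : 2 ≤ n) (hm : 2 ≤ m) (hme : Even m) (hne : Even n) :
    piP n m hn hm =
        (xi2 n m hn hm * xi1 n m hn hm) ^ m *
          (xi2 n m hn hm ^ 2 * xi1 n m hn hm) ^ ((m - 1) * (n ^ 2 - n - 1)) *
            (xi2 n m hn hm ^ 2 * xi1 n m hn hm ^ (m - 1)) ^ ((m - 2) * (n - 1) ^ 2) ∧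
      rhoP n m hn hm =
        ((xi2 n m hn hm ^ 2 * xi1 n m hn hm) ^ ((m - 1) * (n ^ 2 - n - 1)) *
            (xi2 n m hn hm ^ 2 * xi1 n m hn hm ^ (m - 1)) ^ ((m - 2) * (n - 1) ^ 2)) ^ (n - 1) ∧
      pibarP n m hn hm =
        ((xi2 n m hn hm ^ 2 * xi1 n m hn hm) ^ ((m - 1) * (n ^ 2 - n - 1)) *
            (xi2 n m hn hm ^ 2 * xi1 n m hn hm ^ (m - 1)) ^ ((m - 2) * (n - 1) ^ 2)) ^ (n - 1) *
          xi2 n m hn hm ^ (2 * n - 1) ∧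
      rhobarP n m =
        xi2 n m hn hm * xi1 n m hn hm * xi2 n m hn hm ^ (2 * n - 1) *
          (xi2 n m hn hm * xi1 n m hn hm) ^ m *
            ((xi2 n m hn hm ^ 2 * xi1 n m hn hm) ^ ((m - 1) * (n ^ 2 - n - 1)) *
                (xi2 n m hn hm ^ 2 * xi1 n m hn hm ^ (m - 1)) ^ ((m - 2) * (n - 1) ^ 2)) ^ n *
              xi2 n m hn hm ^ (2 * n - 1) := by
  have hword := word_eq_fiberwise n m hn hm hme hne
  have hr := finRotate_pow_self n
  have hpi : piP n m hn hm =
      (xi2 n m hn hm * xi1 n m hn hm) ^ m *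
        ((xi2 n m hn hm ^ 2 * xi1 n m hn hm) ^ ((m - 1) * (n ^ 2 - n - 1)) *
          (xi2 n m hn hm ^ 2 * xi1 n m hn hm ^ (m - 1)) ^ ((m - 2) * (n - 1) ^ 2)) := by
    rw [hword, xi2_mul_xi1_pow n m hn hm hme hne, ← map_mul, piP_eq_fiberwise]
    congr 1
    funext j
    simp only [Pi.mul_apply]
    split_ifs <;> first | omega | simp [-mul_inv_rev]
  have hrho : rhoP n m hn hm =
      ((xi2 n m hn hm ^ 2 * xi1 n m hn hm) ^ ((m - 1) * (n ^ 2 - n - 1)) *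
        (xi2 n m hn hm ^ 2 * xi1 n m hn hm ^ (m - 1)) ^ ((m - 2) * (n - 1) ^ 2)) ^ (n - 1) := by
    rw [hword, ← map_pow, rhoP_eq_fiberwise]
    congr 1
    funext j
    simp only [Pi.pow_apply]
    split_ifs
    · rw [inv_pow, eq_inv_iff_mul_eq_one, ← pow_succ', Nat.sub_add_cancel (by omega), hr]
    · rw [inv_pow, finRotate_mul_swap_pow n hn, inv_one]
    · rw [inv_pow, swap_mul_finRotate_pow n hn, inv_one]
  have hinv : xi2 n m hn hm ^ (2 * n - 1) = (xi2 n m hn hm)⁻¹ := by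
    rw [eq_inv_iff_mul_eq_one, ← pow_succ, Nat.sub_add_cancel (by omega), pow_mul, xi2_sq,
      ← map_pow]
    convert map_one fiberwise using 2
    funext j
    simp only [Pi.pow_apply, Pi.one_apply]
    split_ifs <;> simp [hr]
  have hpibar_inv : (pibarP n m hn hm)⁻¹ = pibarP n m hn hm := by
    rw [inv_eq_iff_mul_eq_one]
    ext1 ⟨i, j⟩
    exact Prod.ext rfl (Equiv.swap_apply_self _ _ j)
  have hpi_mul : piP n m hn hm * piP n m hn hm = 1 := Equiv.swap_mul_self _ _
  rw [← hrho, hinv, mul_assoc (_ ^ m), ← hpi]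
  refine ⟨rfl, rfl, ?_, ?_⟩
  · rw [xi2_eq, mul_inv_rev, mul_inv_cancel_left, hpibar_inv]
  · have hpow : ((xi2 n m hn hm ^ 2 * xi1 n m hn hm) ^ ((m - 1) * (n ^ 2 - n - 1)) *
        (xi2 n m hn hm ^ 2 * xi1 n m hn hm ^ (m - 1)) ^ ((m - 2) * (n - 1) ^ 2)) ^ n =
        ((xi2 n m hn hm * xi1 n m hn hm) ^ m)⁻¹ * piP n m hn hm * rhoP n m hn hm := by
      rw [← mul_pow_sub_one (by omega : n ≠ 0), ← hrho, hpi, inv_mul_cancel_left]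
    rw [hpow, xi2_mul_xi1_eq n m hn hm hme hne, xi2_eq]
    calc rhobarP n m = rhobarP n m * pibarP n m hn hm *
          (piP n m hn hm * piP n m hn hm) * (pibarP n m hn hm)⁻¹ := by rw [hpi_mul]; group
      _ = _ := by group
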